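/- Let n ≥ 1, 0 ≤ p ≤ n, and let B_{p,n} = { φ ∈ C^n(ℝ) : ‖φ^{(k)}‖_∞ ≤ 1 for all p ≤ k ≤ n }. For real random variables X and Y define d_W^{p,n}(X,Y) = sup_{φ ∈ B_{p,n}} E[φ(X) − φ(Y)] and d_∞^{p,n}(X,Y) = sup_{φ ∈ B_{p,n} ∩ C^∞(ℝ)} E[φ(X) − φ(Y)] (suprema taken in [0,∞]). If X and Y admit finite moments of order p, then d_W^{p,n}(X,Y) = d_∞^{p,n}(X,Y). -/

import Mathlib

open MeasureTheory ProbabilityTheory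

open scoped Convolution
open Filter Topology Metric ContinuousLinearMap

/-- Convolution with a compactly supported kernel: the derivative may be taken on the factor
without compact support. -/
theorem HasCompactSupport.hasDerivAt_convolution_of_contDiff {f g : ℝ → ℝ}
    (hcf : HasCompactSupport f) (hf : Continuous f) (hg : ContDiff ℝ 1 g) (x₀ : ℝ) :
    HasDerivAt (f ⋆[lsmul ℝ ℝ, volume] g) ((f ⋆[lsmul ℝ ℝ, volume] deriv g) x₀) x₀ := by
  have hg' : Continuous (deriv g) := hg.continuous_deriv le_rfl
  obtain ⟨M, hM⟩ := ((isCompact_closedBall x₀ 1).prod hcf).exists_bound_of_continuousOn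
    (f := fun q : ℝ × ℝ => deriv g (q.1 - q.2)) (by fun_prop)
  have hint : ∀ h : ℝ → ℝ, Continuous h → Integrable (fun t => f t * h t) := fun h hh =>
    (hf.mul hh).integrable_of_hasCompactSupport hcf.mul_right
  refine (hasDerivAt_integral_of_dominated_loc_of_deriv_le
    (F := fun x t => f t * g (x - t)) (F' := fun x t => f t * deriv g (x - t))
    (bound := fun t => ‖f t‖ * M) (s := closedBall x₀ 1) (closedBall_mem_nhds x₀ one_pos)
    (.of_forall fun x => ?_) (hint _ (hg.continuous.comp (by fun_prop))) ?_
    (.of_forall fun t x hx => ?_) ?_ (.of_forall fun t x _ => ?_)).2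
  · exact (hint _ (hg.continuous.comp (by fun_prop))).aestronglyMeasurable
  · exact (hint _ (hg'.comp (by fun_prop))).aestronglyMeasurable
  · rw [norm_mul]
    by_cases ht : t ∈ tsupport f
    · gcongr
      exact hM (x, t) ⟨hx, ht⟩
    · simp [image_eq_zero_of_notMem_tsupport ht]
  · exact (hf.integrable_of_hasCompactSupport hcf).norm.mul_const M
  · exact ((hg.differentiable one_ne_zero _).hasDerivAt.comp_sub_const x t).const_mul (f t)

theorem HasCompactSupport.iteratedDeriv_convolution {f g : ℝ → ℝ} {n : ℕ}
    (hcf : HasCompactSupport f) (hf : Continuous f) (hg : ContDiff ℝ n g) :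
    ∀ k ≤ n, iteratedDeriv k (f ⋆[lsmul ℝ ℝ, volume] g) =
      f ⋆[lsmul ℝ ℝ, volume] iteratedDeriv k g := by
  intro k
  induction k with
  | zero => simp
  | succ k ih =>
    intro hk
    have hk1 : ContDiff ℝ 1 (iteratedDeriv k g) := by
      rw [iteratedDeriv_eq_iterate]
      exact ContDiff.iterate_deriv' 1 k (hg.of_le (by norm_cast; omega))
    rw [iteratedDeriv_succ, iteratedDeriv_succ, ih (by omega)]
    exact funext fun x => (hcf.hasDerivAt_convolution_of_contDiff hf hk1 x).deriv

/-- A normed bump function averages: pointwise bounds on the ball carry over to the convolution. -/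
theorem ContDiffBump.abs_normed_convolution_le (ρ : ContDiffBump (0 : ℝ)) {g : ℝ → ℝ}
    (hg : Continuous g) {x C : ℝ} (hC : ∀ y ∈ ball x ρ.rOut, |g y| ≤ C) :
    |(ρ.normed volume ⋆[lsmul ℝ ℝ, volume] g) x| ≤ C := by
  have h := dist_convolution_le (μ := volume) (f := ρ.normed volume) (g := g) (x₀ := x)
    (z₀ := 0) ((abs_nonneg _).trans (hC x (mem_ball_self ρ.rOut_pos)))
    ρ.support_normed_eq.subset ρ.nonneg_normed ρ.integral_normed hg.aestronglyMeasurable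
    (by simpa using hC)
  simpa using h

theorem ContDiff.abs_le_mul_one_add_abs_pow {p : ℕ} : ∀ {g : ℝ → ℝ}, ContDiff ℝ p g →
    (∀ x, |iteratedDeriv p g x| ≤ 1) → ∃ C, 0 ≤ C ∧ ∀ x, |g x| ≤ C * (1 + |x|) ^ p := by
  induction p with
  | zero => exact fun _ h => ⟨1, zero_le_one, by simpa using h⟩
  | succ p ih =>
    intro g hg h
    have hg' := contDiff_succ_iff_deriv.1 (show ContDiff ℝ ((p : WithTop ℕ∞) + 1) g from hg)
    obtain ⟨C, hC, hb⟩ := ih hg'.2.2 (by simpa [iteratedDeriv_succ'] using h)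
    refine ⟨|g 0| + C, by positivity, fun x => ?_⟩
    have hmv := (convex_closedBall (0 : ℝ) |x|).norm_image_sub_le_of_norm_deriv_le
      (f := g) (C := C * (1 + |x|) ^ p) (x := 0) (y := x)
      (fun y _ => hg'.1 y) (fun y hy => (hb y).trans ?_) (by simp) (by simp)
    · simp only [Real.norm_eq_abs, sub_zero] at hmv
      have h1 : |g x| ≤ |g 0| + |g x - g 0| := by
        simpa using abs_add_le (g 0) (g x - g 0)
      have h2 : (1 : ℝ) ≤ (1 + |x|) ^ (p + 1) := one_le_pow₀ (by simp)
      have h3 : C * (1 + |x|) ^ p * |x| ≤ C * (1 + |x|) ^ (p + 1) := by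
        rw [pow_succ, mul_assoc]
        gcongr
        simp
      nlinarith [mul_le_mul_of_nonneg_left h2 (abs_nonneg (g 0))]
    · have : |y| ≤ |x| := by simpa using hy
      gcongr

theorem MeasureTheory.Integrable.const_add_abs_pow {Ω : Type*} [MeasurableSpace Ω]
    {μ : Measure Ω} [IsFiniteMeasure μ] {p : ℕ} {X : Ω → ℝ} (hX : Measurable X)
    (hXp : Integrable (fun ω => |X ω| ^ p) μ) {a : ℝ} (ha : 0 ≤ a) :
    Integrable (fun ω => (a + |X ω|) ^ p) μ := by
  refine (((integrable_const (a ^ p)).add hXp).const_mul (2 ^ (p - 1))).mono'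
    (by fun_prop) (.of_forall fun ω => ?_)
  rw [Real.norm_of_nonneg (by positivity)]
  exact add_pow_le ha (abs_nonneg _) p

/-- Mollifications of a function of growth at most `|x| ^ p` satisfy a uniform growth bound. -/
theorem ContDiffBump.abs_normed_convolution_le_growth (ρ : ContDiffBump (0 : ℝ))
    (hρ : ρ.rOut ≤ 1) {g : ℝ → ℝ} (hg : Continuous g) {C : ℝ} (hC : 0 ≤ C) {p : ℕ}
    (hb : ∀ x, |g x| ≤ C * (1 + |x|) ^ p) (x : ℝ) :
    |(ρ.normed volume ⋆[lsmul ℝ ℝ, volume] g) x| ≤ C * (2 + |x|) ^ p := by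
  refine ρ.abs_normed_convolution_le hg fun y hy => (hb y).trans ?_
  have h1 : |y - x| < ρ.rOut := by simpa [Real.dist_eq] using hy
  have h2 : |y| ≤ |y - x| + |x| := by simpa using abs_add_le (y - x) x
  gcongr ?_ * ?_ ^ p
  linarith

/-- **Lemma A.1 (`lem:app1`).** For `1 ≤ n`, `p ≤ n`, and real random variables `X, Y`
with finite moments of order `p`, the smooth distance built from test functions in
`B_{p,n}` (all derivatives of orders `p,…,n` bounded by `1`) equals the one built from
`B_{p,n} ∩ C^∞(ℝ)`; the suprema of `E[φ(X)] − E[φ(Y)]` are taken in `[0,∞]`, over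
test functions for which both expectations exist. -/
theorem smooth_distance_eq_smooth_distance_Cinfty
    {Ω : Type*} [MeasureSpace Ω] [IsProbabilityMeasure (ℙ : Measure Ω)]
    (n p : ℕ) (hn : 1 ≤ n) (hpn : p ≤ n)
    (X Y : Ω → ℝ) (hX : Measurable X) (hY : Measurable Y)
    (hXp : Integrable (fun ω => |X ω| ^ p) ℙ)
    (hYp : Integrable (fun ω => |Y ω| ^ p) ℙ) :
    (⨆ φ ∈ {φ : ℝ → ℝ |
        (ContDiff ℝ n φ ∧ ∀ k, p ≤ k → k ≤ n → ∀ x, |iteratedDeriv k φ x| ≤ 1) ∧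
        Integrable (fun ω => φ (X ω)) ℙ ∧ Integrable (fun ω => φ (Y ω)) ℙ},
      ENNReal.ofReal ((∫ ω, φ (X ω)) - ∫ ω, φ (Y ω))) =
    (⨆ φ ∈ {φ : ℝ → ℝ |
        ((ContDiff ℝ n φ ∧ ∀ k, p ≤ k → k ≤ n → ∀ x, |iteratedDeriv k φ x| ≤ 1) ∧
          ContDiff ℝ ((⊤ : ℕ∞) : WithTop ℕ∞) φ) ∧
        Integrable (fun ω => φ (X ω)) ℙ ∧ Integrable (fun ω => φ (Y ω)) ℙ},
      ENNReal.ofReal ((∫ ω, φ (X ω)) - ∫ ω, φ (Y ω))) := by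
  refine le_antisymm (iSup₂_le ?_) (biSup_mono fun φ h => ⟨h.1.1, h.2⟩)
  rintro φ ⟨⟨hφ, hbd⟩, -, -⟩
  obtain ⟨C, hC, hgrowth⟩ := ContDiff.abs_le_mul_one_add_abs_pow (hφ.of_le (by exact_mod_cast hpn))
    (hbd p le_rfl hpn)
  let ρ : ℕ → ContDiffBump (0 : ℝ) := fun m =>
    ⟨1 / ((m : ℝ) + 1) / 2, 1 / ((m : ℝ) + 1), by positivity, half_lt_self (by positivity)⟩
  have hρ : ∀ m, (ρ m).rOut ≤ 1 := fun m => by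
    change 1 / ((m : ℝ) + 1) ≤ 1
    exact div_le_one_of_le₀ (by simp) (by positivity)
  have hρ0 : Tendsto (fun m => (ρ m).rOut) atTop (𝓝 0) := tendsto_one_div_add_atTop_nhds_zero_nat
  let ψ : ℕ → ℝ → ℝ := fun m => (ρ m).normed volume ⋆[lsmul ℝ ℝ, volume] φ
  have hψ : ∀ m, ContDiff ℝ ((⊤ : ℕ∞) : WithTop ℕ∞) (ψ m) := fun m =>
    (ρ m).hasCompactSupport_normed.contDiff_convolution_left _ (ρ m).contDiff_normed
      hφ.continuous.locallyIntegrable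
  have hψbd : ∀ m k, p ≤ k → k ≤ n → ∀ x, |iteratedDeriv k (ψ m) x| ≤ 1 := fun m k hpk hkn x => by
    rw [(ρ m).hasCompactSupport_normed.iteratedDeriv_convolution (ρ m).continuous_normed hφ k hkn]
    exact (ρ m).abs_normed_convolution_le
      (hφ.continuous_iteratedDeriv k (by exact_mod_cast hkn)) fun y _ => hbd k hpk hkn y
  have key : ∀ Z : Ω → ℝ, Measurable Z → Integrable (fun ω => |Z ω| ^ p) ℙ →
      (∀ m, Integrable (fun ω => ψ m (Z ω)) ℙ) ∧
      Tendsto (fun m => ∫ ω, ψ m (Z ω)) atTop (𝓝 (∫ ω, φ (Z ω))) := by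
    intro Z hZ hZp
    have hdom := (hZp.const_add_abs_pow hZ zero_le_two).const_mul C
    have hmeas : ∀ m, AEStronglyMeasurable (fun ω => ψ m (Z ω)) ℙ := fun m =>
      ((hψ m).continuous.measurable.comp hZ).aestronglyMeasurable
    have hle : ∀ m, ∀ᵐ ω ∂ℙ, ‖ψ m (Z ω)‖ ≤ C * (2 + |Z ω|) ^ p := fun m => .of_forall fun ω =>
      (ρ m).abs_normed_convolution_le_growth (hρ m) hφ.continuous hC hgrowth (Z ω)
    exact ⟨fun m => hdom.mono' (hmeas m) (hle m),
      tendsto_integral_of_dominated_convergence _ hmeas hdom hle (.of_forall fun ω =>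
        ContDiffBump.convolution_tendsto_right_of_continuous hρ0 hφ.continuous (Z ω))⟩
  obtain ⟨hXi, hXt⟩ := key X hX hXp
  obtain ⟨hYi, hYt⟩ := key Y hY hYp
  refine le_of_tendsto (ENNReal.tendsto_ofReal (hXt.sub hYt)) (.of_forall fun m => ?_)
  exact le_iSup₂_of_le (ψ m)
    ⟨⟨⟨(hψ m).of_le (by exact_mod_cast le_top), hψbd m⟩, hψ m⟩, hXi m, hYi m⟩ le_rfl
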